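/- arXiv:2402.05379 — 2 statements merged into one kernel-verified Lean document; each statement's English description precedes it below -/
import Mathlib

section
/- For the categorical distribution with one-hot sufficient statistics, the maximum tensor eigenvalue of the fourth central moment tensor satisfies λ̃_max(K(t|x)) ≤ 2·λ_max(𝓘(h|x)). -/
open MeasureTheory ProbabilityTheory Matrix

noncomputable section

namespace FIMPaper

variable {Y : Type*} [MeasurableSpace Y] {T : ℕ}

/-- Mean `η` of the sufficient statistic `t` under a distribution `μ` (= `p(y|x)` for fixed x). -/
def meanT (μ : Measure Y) (t : Y → Fin T → ℝ) (a : Fin T) : ℝ := ∫ y, t y a ∂μ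

/-- Covariance matrix `𝓘(h|x)` of the sufficient statistic `t` under `μ`. -/
def covT (μ : Measure Y) (t : Y → Fin T → ℝ) : Matrix (Fin T) (Fin T) ℝ :=
  Matrix.of fun a b => ∫ y, (t y a - meanT μ t a) * (t y b - meanT μ t b) ∂μ

lemma covT_isHermitian (μ : Measure Y) (t : Y → Fin T → ℝ) : (covT μ t).IsHermitian := by
  show (covT μ t)ᴴ = covT μ t
  ext a b
  simp only [Matrix.conjTranspose_apply, covT, Matrix.of_apply, star_trivial]
  exact integral_congr_ae (Filter.Eventually.of_forall fun y => mul_comm _ _)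

/-- Fourth central moment tensor `K(t|x)` of the sufficient statistic `t` under `μ`. -/
def K4 (μ : Measure Y) (t : Y → Fin T → ℝ) (a b c d : Fin T) : ℝ :=
  ∫ y, (t y a - meanT μ t a) * (t y b - meanT μ t b) * (t y c - meanT μ t c) *
    (t y d - meanT μ t d) ∂μ

/-- Maximum eigenvalue `λ_max` of a symmetric (Hermitian) real matrix. -/
def lamMax {n : Type*} [Fintype n] [DecidableEq n] {A : Matrix n n ℝ}
    (hA : A.IsHermitian) : ℝ := ⨆ i, hA.eigenvalues i

/-- Minimum eigenvalue `λ_min` of a symmetric (Hermitian) real matrix. -/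
def lamMin {n : Type*} [Fintype n] [DecidableEq n] {A : Matrix n n ℝ}
    (hA : A.IsHermitian) : ℝ := ⨅ i, hA.eigenvalues i

/-- Minimum (Z-)eigenvalue `λ̃_min` of a 4-index tensor, defined variationally. -/
def tlamMin (𝒯 : Fin T → Fin T → Fin T → Fin T → ℝ) : ℝ :=
  sInf {r | ∃ u : Fin T → ℝ, ∑ a, u a ^ 2 = 1 ∧
    r = ∑ a, ∑ b, ∑ c, ∑ d, u a * u b * u c * u d * 𝒯 a b c d}

/-- Maximum (Z-)eigenvalue `λ̃_max` of a 4-index tensor, defined variationally. -/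
def tlamMax (𝒯 : Fin T → Fin T → Fin T → Fin T → ℝ) : ℝ :=
  sSup {r | ∃ u : Fin T → ℝ, ∑ a, u a ^ 2 = 1 ∧
    r = ∑ a, ∑ b, ∑ c, ∑ d, u a * u b * u c * u d * 𝒯 a b c d}

/-- Eigenvalues of a Hermitian matrix sorted in ascending order. -/
def eigAsc {n : Type*} [Fintype n] [DecidableEq n] {A : Matrix n n ℝ}
    (hA : A.IsHermitian) : Fin (Fintype.card n) → ℝ :=
  fun i =>
    (fun j => hA.eigenvalues ((Fintype.equivFin n).symm j)) ∘
      (Tuple.sort fun j => hA.eigenvalues ((Fintype.equivFin n).symm j)) <| i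

/-- Eigenvalues of a Hermitian matrix sorted in descending order:
`eigDesc hA t` is the `t`-th largest eigenvalue (0-indexed). -/
def eigDesc {n : Type*} [Fintype n] [DecidableEq n] {A : Matrix n n ℝ}
    (hA : A.IsHermitian) : Fin (Fintype.card n) → ℝ :=
  fun i => eigAsc hA i.rev


/-- Softmax of the logits `h`. -/
def softmax {C : ℕ} (h : Fin C → ℝ) (k : Fin C) : ℝ :=
  Real.exp (h k) / ∑ j, Real.exp (h j)

/-- Covariance matrix `𝓘(h|x) = diag(σ) − σσᵀ` of the one-hot sufficient statistic of a
categorical distribution with class probabilities `σ`. -/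
def catCov {C : ℕ} (σ : Fin C → ℝ) : Matrix (Fin C) (Fin C) ℝ :=
  Matrix.of fun a b => (if a = b then σ a else 0) - σ a * σ b

lemma catCov_isHermitian {C : ℕ} (σ : Fin C → ℝ) : (catCov σ).IsHermitian := by
  show (catCov σ)ᴴ = catCov σ
  ext a b
  simp only [Matrix.conjTranspose_apply, catCov, Matrix.of_apply, star_trivial]
  by_cases hab : b = a
  · subst hab; ring
  · rw [if_neg hab, if_neg fun hba => hab hba.symm]
    ring

/-- Fourth central moment tensor `K(t|x)` of the one-hot sufficient statistic
`t(y) = (⟦y=1⟧,…,⟦y=C⟧)` of a categorical distribution with class probabilities `σ`. -/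
def catK4 {C : ℕ} (σ : Fin C → ℝ) (a b c d : Fin C) : ℝ :=
  ∑ k, σ k *
    (((if k = a then (1 : ℝ) else 0) - σ a) * ((if k = b then (1 : ℝ) else 0) - σ b) *
      ((if k = c then (1 : ℝ) else 0) - σ c) * ((if k = d then (1 : ℝ) else 0) - σ d))

lemma softmax_nonneg {C : ℕ} (h : Fin C → ℝ) (k : Fin C) : 0 ≤ softmax h k := by
  unfold softmax
  positivity

lemma sum_softmax {C : ℕ} [NeZero C] (h : Fin C → ℝ) : ∑ k, softmax h k = 1 := by
  have : 0 < ∑ j, Real.exp (h j) :=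
    Finset.sum_pos (fun _ _ => Real.exp_pos _) Finset.univ_nonempty
  simp only [softmax, ← Finset.sum_div]
  exact div_self this.ne'

/-- The quadratic form of a Hermitian matrix on a unit vector is at most its largest eigenvalue. -/
lemma dotProduct_mulVec_le_lamMax {n : Type*} [Fintype n] [DecidableEq n] {A : Matrix n n ℝ}
    (hA : A.IsHermitian) (u : n → ℝ) (hu : ∑ a, u a ^ 2 = 1) :
    u ⬝ᵥ A *ᵥ u ≤ lamMax hA := by
  set b := hA.eigenvectorBasis
  set x : EuclideanSpace ℝ n := WithLp.toLp 2 u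
  set c : n → ℝ := fun i => inner ℝ x (b i)
  have hsq : ∑ i, c i * c i = 1 := by
    have key := b.sum_inner_mul_inner x x
    simp only [real_inner_comm x] at key
    rw [← hu, key, real_inner_self_eq_norm_sq, EuclideanSpace.real_norm_sq_eq]
  have hform : ∑ i, c i * (hA.eigenvalues i * c i) = u ⬝ᵥ A *ᵥ u := by
    have key := b.sum_inner_mul_inner x (WithLp.toLp 2 (A *ᵥ u))
    have hsymm : ∀ i, inner ℝ (b i) (WithLp.toLp 2 (A *ᵥ u)) = hA.eigenvalues i * c i := by
      intro i
      have hT : Aᵀ = A := by simpa [Matrix.conjTranspose_eq_transpose_of_trivial] using hA.eq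
      have hev : A *ᵥ ⇑(b i) = hA.eigenvalues i • ⇑(b i) := hA.mulVec_eigenvectorBasis i
      rw [EuclideanSpace.inner_eq_star_dotProduct]
      simp only [star_trivial, c, x, EuclideanSpace.inner_eq_star_dotProduct]
      rw [dotProduct_comm, dotProduct_mulVec, ← mulVec_transpose, hT, hev, smul_dotProduct,
        smul_eq_mul]
    simp only [hsymm] at key
    rw [key, EuclideanSpace.inner_eq_star_dotProduct, star_trivial, dotProduct_comm]
  calc u ⬝ᵥ A *ᵥ u = ∑ i, hA.eigenvalues i * (c i * c i) := by
        rw [← hform]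
        exact Finset.sum_congr rfl fun _ _ => by ring
    _ ≤ ∑ i, lamMax hA * (c i * c i) :=
        Finset.sum_le_sum fun i _ => mul_le_mul_of_nonneg_right
          (le_ciSup (Set.finite_range hA.eigenvalues).bddAbove i) (mul_self_nonneg _)
    _ = lamMax hA := by rw [← Finset.mul_sum, hsq, mul_one]

lemma sum_mul_ite_sub {C : ℕ} (σ u : Fin C → ℝ) (k : Fin C) :
    ∑ a, u a * ((if k = a then (1 : ℝ) else 0) - σ a) = u k - ∑ a, σ a * u a := by
  simp [mul_sub, Finset.sum_sub_distrib, mul_comm]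

lemma dotProduct_catCov_mulVec {C : ℕ} (σ u : Fin C → ℝ) (hσ : ∑ k, σ k = 1) :
    u ⬝ᵥ catCov σ *ᵥ u = ∑ k, σ k * (u k - ∑ a, σ a * u a) ^ 2 := by
  set m := ∑ a, σ a * u a with hm
  have hmul : ∀ a, (catCov σ *ᵥ u) a = σ a * u a - σ a * m := by
    intro a
    simp [mulVec, dotProduct, catCov, sub_mul, Finset.sum_sub_distrib, hm, Finset.mul_sum,
      mul_assoc]
  have hexp : ∀ k, σ k * (u k - m) ^ 2 =
      u k * (σ k * u k - σ k * m) - m * (σ k * u k) + m ^ 2 * σ k := fun k => by ring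
  simp only [dotProduct, hmul, hexp, Finset.sum_add_distrib, Finset.sum_sub_distrib,
    ← Finset.mul_sum, hσ, ← hm]
  ring

lemma sum_catK4 {C : ℕ} (σ u : Fin C → ℝ) :
    ∑ a, ∑ b, ∑ c, ∑ d, u a * u b * u c * u d * catK4 σ a b c d =
      ∑ k, σ k * (u k - ∑ a, σ a * u a) ^ 4 := by
  set f : Fin C → Fin C → ℝ := fun k a => u a * ((if k = a then (1 : ℝ) else 0) - σ a) with hf
  have hterm : ∀ a b c d, u a * u b * u c * u d * catK4 σ a b c d =
      ∑ k, σ k * (f k a * (f k b * (f k c * f k d))) := by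
    intro a b c d
    rw [catK4, Finset.mul_sum]
    exact Finset.sum_congr rfl fun k _ => by simp only [hf]; ring
  have hswap : ∀ F : Fin C → Fin C → Fin C → Fin C → Fin C → ℝ,
      ∑ k, ∑ a, ∑ b, ∑ c, ∑ d, F a b c d k = ∑ a, ∑ b, ∑ c, ∑ d, ∑ k, F a b c d k := by
    intro F
    rw [Finset.sum_comm]
    refine Finset.sum_congr rfl fun a _ => ?_
    rw [Finset.sum_comm]
    refine Finset.sum_congr rfl fun b _ => ?_
    rw [Finset.sum_comm]
    refine Finset.sum_congr rfl fun c _ => ?_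
    exact Finset.sum_comm
  simp only [hterm]
  rw [← hswap]
  refine Finset.sum_congr rfl fun k _ => ?_
  simp only [← Finset.mul_sum, ← Finset.sum_mul, hf, sum_mul_ite_sub]
  ring

lemma sq_sub_sum_mul_le_two {C : ℕ} (σ u : Fin C → ℝ) (hσ₀ : ∀ k, 0 ≤ σ k)
    (hσ : ∑ k, σ k = 1) (hu : ∑ a, u a ^ 2 = 1) (k : Fin C) :
    (u k - ∑ a, σ a * u a) ^ 2 ≤ 2 := by
  have hσ₁ : ∀ a, σ a ≤ 1 := fun a =>
    hσ ▸ Finset.single_le_sum (fun i _ => hσ₀ i) (Finset.mem_univ a)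
  have hsq : ∀ a, ((if k = a then (1 : ℝ) else 0) - σ a) ^ 2 ≤
      (if k = a then (1 : ℝ) else 0) + σ a := by
    intro a
    have h₀ := hσ₀ a
    have h₁ := hσ₁ a
    split_ifs <;> nlinarith
  calc (u k - ∑ a, σ a * u a) ^ 2
      = (∑ a, u a * ((if k = a then (1 : ℝ) else 0) - σ a)) ^ 2 := by rw [sum_mul_ite_sub]
    _ ≤ (∑ a, u a ^ 2) * ∑ a, ((if k = a then (1 : ℝ) else 0) - σ a) ^ 2 :=
        Finset.sum_mul_sq_le_sq_mul_sq _ _ _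
    _ ≤ ∑ a, ((if k = a then (1 : ℝ) else 0) + σ a) := by
        rw [hu, one_mul]
        exact Finset.sum_le_sum fun a _ => hsq a
    _ = 2 := by
        rw [Finset.sum_add_distrib, hσ]
        norm_num

/-- For the categorical exponential family over `C` classes with one-hot
sufficient statistics and logits `h(x)` (so `σ(x) = SoftMax(h(x))` and
`𝓘(h|x) = diag(σ(x)) − σ(x)σ(x)ᵀ`), the maximum tensor eigenvalue of the fourth central moment
tensor satisfies `λ̃_max(K(t|x)) ≤ 2·λ_max(𝓘(h|x))`. -/
theorem categorical_fourth_moment_bound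
    {X : Type*} {C : ℕ} [NeZero C] (h : X → Fin C → ℝ) :
    ∀ x : X,
      tlamMax (catK4 (softmax (h x))) ≤ 2 * lamMax (catCov_isHermitian (softmax (h x))) := by
  intro x
  have hσ₀ := softmax_nonneg (h x)
  have hσ := sum_softmax (h x)
  generalize softmax (h x) = σ at hσ₀ hσ ⊢
  refine csSup_le ⟨_, Pi.single 0 1, by simp [Pi.single_apply], rfl⟩ ?_
  rintro r ⟨u, hu, rfl⟩
  rw [sum_catK4]
  calc ∑ k, σ k * (u k - ∑ a, σ a * u a) ^ 4
      ≤ ∑ k, 2 * (σ k * (u k - ∑ a, σ a * u a) ^ 2) := by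
        refine Finset.sum_le_sum fun k _ => ?_
        have hk := mul_le_mul_of_nonneg_left (sq_sub_sum_mul_le_two σ u hσ₀ hσ hu k)
          (mul_nonneg (hσ₀ k) (sq_nonneg (u k - ∑ a, σ a * u a)))
        linarith
    _ = 2 * (u ⬝ᵥ catCov σ *ᵥ u) := by rw [dotProduct_catCov_mulVec σ u hσ, Finset.mul_sum]
    _ ≤ 2 * lamMax (catCov_isHermitian σ) :=
        mul_le_mul_of_nonneg_left (dotProduct_mulVec_le_lamMax _ u hu) zero_le_two

end FIMPaper
end
end

section
/- For any input x, the variance of the empirical-Fisher diagonal estimator satisfies V(θ_i|x) = (1/N)·Σ_{abcd} ∂_i h^a(x) ∂_i h^b(x) ∂_i h^c(x) ∂_i h^d(x)·( K̄_{abcd}(t|x) − I_{ab}(h|x)·I_{cd}(h|x) ), which equals (1/N)·Σ_{abcd} ∂_i h^a ∂_i h^b ∂_i h^c ∂_i h^d K̄_{abcd}(t|x) − (1/N)·( ∂_i h(x)ᵀ (Cov^q(t|x) + ΔH(x)) ∂_i h(x) )². -/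
open MeasureTheory ProbabilityTheory Matrix

noncomputable section

namespace FIMPaper

variable {Y : Type*} [MeasurableSpace Y] {T : ℕ}

/-- The square of a linear form, expanded as a double sum. -/
lemma sq_sum_mul (v s : Fin T → ℝ) :
    (∑ a, v a * s a) ^ 2 = ∑ a, ∑ b, v a * v b * (s a * s b) := by
  rw [sq, Finset.sum_mul_sum]
  exact Finset.sum_congr rfl fun a _ => Finset.sum_congr rfl fun b _ => by ring

/-- The fourth power of a linear form, expanded as a quadruple sum. -/
lemma sq_sq_sum_mul (v s : Fin T → ℝ) :
    ((∑ a, v a * s a) ^ 2) ^ 2 =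
      ∑ a, ∑ b, ∑ c, ∑ d, v a * v b * v c * v d * (s a * s b * s c * s d) := by
  rw [sq_sum_mul, sq]
  simp only [Finset.sum_mul, Finset.mul_sum]
  refine Finset.sum_congr rfl fun a _ => Finset.sum_congr rfl fun b _ =>
    Finset.sum_congr rfl fun c _ => Finset.sum_congr rfl fun d _ => by ring

/-- The square of a quadratic form, expanded as a quadruple sum. -/
lemma sq_quadratic_form (v : Fin T → ℝ) (M : Fin T → Fin T → ℝ) :
    (∑ a, ∑ b, v a * v b * M a b) ^ 2 =
      ∑ a, ∑ b, ∑ c, ∑ d, v a * v b * v c * v d * (M a b * M c d) := by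
  rw [sq]
  simp only [Finset.sum_mul, Finset.mul_sum]
  refine Finset.sum_congr rfl fun a _ => Finset.sum_congr rfl fun b _ =>
    Finset.sum_congr rfl fun c _ => Finset.sum_congr rfl fun d _ => by ring

/-- The variance of the empirical mean of `N` i.i.d. copies of a square-integrable variable. -/
lemma variance_empirical_mean {N : ℕ} (hN : 0 < N) (μ : Measure Y) [IsProbabilityMeasure μ]
    {f : Y → ℝ} (hf : MemLp f 2 μ) :
    variance (fun ys : Fin N → Y => (N : ℝ)⁻¹ * ∑ k, f (ys k)) (Measure.pi fun _ => μ) =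
      (N : ℝ)⁻¹ * variance f μ := by
  have hsum := variance_sum_pi (μ := fun _ : Fin N => μ) (X := fun _ => f) fun _ => hf
  have hfun : (∑ k : Fin N, fun ys : Fin N → Y => f (ys k)) = fun ys => ∑ k, f (ys k) := by
    ext ys
    simp
  rw [hfun] at hsum
  have hN' : (N : ℝ) ≠ 0 := by positivity
  rw [variance_const_mul, hsum]
  simp only [Finset.sum_const, Finset.card_univ, Fintype.card_fin, nsmul_eq_mul]
  field_simp

section Moments

variable {μ : Measure Y} {s : Y → Fin T → ℝ}

/-- Integrable fourth moments make products of two coordinates square-integrable. -/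
lemma memLp_two_mul (hs : Measurable s)
    (h4 : ∀ a b c d, Integrable (fun y => s y a * s y b * s y c * s y d) μ) (a b : Fin T) :
    MemLp (fun y => s y a * s y b) 2 μ := by
  rw [memLp_two_iff_integrable_sq (by fun_prop)]
  exact (h4 a b a b).congr (Filter.Eventually.of_forall fun y => by ring)

variable [IsProbabilityMeasure μ]

lemma integrable_coord (hs : Measurable s)
    (h4 : ∀ a b c d, Integrable (fun y => s y a * s y b * s y c * s y d) μ) (a : Fin T) :
    Integrable (fun y => s y a) μ := by
  have h2 : MemLp (fun y => s y a) 2 μ := by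
    rw [memLp_two_iff_integrable_sq (by fun_prop)]
    exact ((memLp_two_mul hs h4 a a).integrable one_le_two).congr
      (Filter.Eventually.of_forall fun y => by ring)
  exact h2.integrable one_le_two

/-- The variance of the squared linear form, through the second and fourth moments. -/
lemma variance_sq_sum_mul (hs : Measurable s)
    (h4 : ∀ a b c d, Integrable (fun y => s y a * s y b * s y c * s y d) μ) (v : Fin T → ℝ) :
    MemLp (fun y => (∑ a, v a * s y a) ^ 2) 2 μ ∧
    variance (fun y => (∑ a, v a * s y a) ^ 2) μ =
      (∑ a, ∑ b, ∑ c, ∑ d, v a * v b * v c * v d * ∫ y, s y a * s y b * s y c * s y d ∂μ) -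
        (∑ a, ∑ b, v a * v b * ∫ y, s y a * s y b ∂μ) ^ 2 := by
  have hmem : MemLp (fun y => (∑ a, v a * s y a) ^ 2) 2 μ := by
    simp only [sq_sum_mul]
    exact memLp_finsetSum _ fun a _ => memLp_finsetSum _ fun b _ =>
      (memLp_two_mul hs h4 a b).const_mul _
  refine ⟨hmem, ?_⟩
  rw [variance_eq_sub hmem]
  simp only [Pi.pow_apply, sq_sq_sum_mul]
  congr 1
  · have hi a b c d := (h4 a b c d).const_mul (v a * v b * v c * v d)
    rw [integral_finsetSum _ fun a _ => integrable_finsetSum _ fun b _ =>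
      integrable_finsetSum _ fun c _ => integrable_finsetSum _ fun d _ => hi a b c d]
    refine Finset.sum_congr rfl fun a _ => ?_
    rw [integral_finsetSum _ fun b _ =>
      integrable_finsetSum _ fun c _ => integrable_finsetSum _ fun d _ => hi a b c d]
    refine Finset.sum_congr rfl fun b _ => ?_
    rw [integral_finsetSum _ fun c _ => integrable_finsetSum _ fun d _ => hi a b c d]
    refine Finset.sum_congr rfl fun c _ => ?_
    rw [integral_finsetSum _ fun d _ => hi a b c d]
    exact Finset.sum_congr rfl fun d _ => integral_const_mul _ _
  · have hi a b := ((memLp_two_mul hs h4 a b).integrable one_le_two).const_mul (v a * v b)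
    simp only [sq_sum_mul]
    rw [integral_finsetSum _ fun a _ => integrable_finsetSum _ fun b _ => hi a b]
    congr 1
    refine Finset.sum_congr rfl fun a _ => ?_
    rw [integral_finsetSum _ fun b _ => hi a b]
    exact Finset.sum_congr rfl fun b _ => integral_const_mul _ _

end Moments

/-- Second moments about a point `η` decompose into covariance and squared bias. -/
lemma integral_sub_mul_sub {μ : Measure Y} [IsProbabilityMeasure μ] {t : Y → Fin T → ℝ}
    (η : Fin T → ℝ) {a b : Fin T} (ha : Integrable (fun y => t y a) μ)
    (hb : Integrable (fun y => t y b) μ)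
    (hab : Integrable (fun y => (t y a - η a) * (t y b - η b)) μ) :
    ∫ y, (t y a - η a) * (t y b - η b) ∂μ =
      covT μ t a b + (η a - meanT μ t a) * (η b - meanT μ t b) := by
  have hca : ∫ y, (t y a - η a) ∂μ = meanT μ t a - η a := by
    rw [integral_sub ha (integrable_const _)]
    simp [meanT]
  have hcb : ∫ y, (t y b - η b) ∂μ = meanT μ t b - η b := by
    rw [integral_sub hb (integrable_const _)]
    simp [meanT]
  have hia : Integrable (fun y => t y a - η a) μ := ha.sub (integrable_const _)
  have hib : Integrable (fun y => t y b - η b) μ := hb.sub (integrable_const _)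
  have hcov : covT μ t a b = ∫ y, ((t y a - η a) * (t y b - η b)
      + (η b - meanT μ t b) * (t y a - η a) + (η a - meanT μ t a) * (t y b - η b)
      + (η a - meanT μ t a) * (η b - meanT μ t b)) ∂μ := by
    simp only [covT, Matrix.of_apply]
    exact integral_congr_ae (Filter.Eventually.of_forall fun y => by ring)
  have h1 : Integrable (fun y => (t y a - η a) * (t y b - η b)
      + (η b - meanT μ t b) * (t y a - η a)) μ := hab.add (hia.const_mul _)
  have h2 : Integrable (fun y => (t y a - η a) * (t y b - η b)
      + (η b - meanT μ t b) * (t y a - η a) + (η a - meanT μ t a) * (t y b - η b)) μ :=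
    h1.add (hib.const_mul _)
  rw [hcov, integral_add h2 (integrable_const _), integral_add h1 (hib.const_mul _),
    integral_add hab (hia.const_mul _), integral_const_mul, integral_const_mul, hca, hcb]
  simp only [integral_const, probReal_univ, one_smul]
  ring

/-- Variance of the empirical-Fisher diagonal estimator
`Î_E(θ_i|x) = (1/N) ∑_k (∂_i h(x)ᵀ(t(ŷ_k) − η(x)))²` with `ŷ_1,…,ŷ_N` i.i.d. from the data
conditional `q(ŷ|x) = νc x`, where `η(x)` is the *model* mean under `pm x = p(·|x)`:
`V(θ_i|x) = (1/N)∑_{abcd} ∂_i h^a ∂_i h^b ∂_i h^c ∂_i h^d (K̄_{abcd}(t|x) − I_{ab}(h|x)I_{cd}(h|x))`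
` = (1/N)∑_{abcd} ∂_i h^a ∂_i h^b ∂_i h^c ∂_i h^d K̄_{abcd}(t|x)
    − (1/N)(∂_i h(x)ᵀ(Cov^q(t|x) + ΔH(x))∂_i h(x))²`,
where `K̄` is the fourth non-central moment tensor of `t(ŷ)−η(x)` under `q(ŷ|x)`,
`I(h|x)` its second non-central moment, `Cov^q(t|x)` its covariance and
`ΔH(x) = (η(x)−η̂(x))(η(x)−η̂(x))ᵀ`. -/
theorem empirical_fisher_variance_closed_form
    {X Y : Type*} [MeasurableSpace Y] {T dimθ N : ℕ} (hN : 0 < N)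
    (pm : X → Measure Y) (hpm : ∀ x, IsProbabilityMeasure (pm x))
    (νc : X → Measure Y) (hνc : ∀ x, IsProbabilityMeasure (νc x))
    (t : Y → Fin T → ℝ) (ht : Measurable t)
    (ht4 : ∀ (x : X) (a b c d : Fin T), Integrable (fun y =>
      (t y a - meanT (pm x) t a) * (t y b - meanT (pm x) t b) *
      (t y c - meanT (pm x) t c) * (t y d - meanT (pm x) t d)) (νc x))
    (dh : X → Fin dimθ → Fin T → ℝ) :
    ∀ (x : X) (i : Fin dimθ),
      (variance
          (fun ys : Fin N → Y =>
            (N : ℝ)⁻¹ * ∑ k, (∑ a, dh x i a * (t (ys k) a - meanT (pm x) t a)) ^ 2)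
          (Measure.pi fun _ => νc x) =
        (N : ℝ)⁻¹ * ∑ a, ∑ b, ∑ c, ∑ d,
          dh x i a * dh x i b * dh x i c * dh x i d *
            ((∫ y, (t y a - meanT (pm x) t a) * (t y b - meanT (pm x) t b) *
                (t y c - meanT (pm x) t c) * (t y d - meanT (pm x) t d) ∂(νc x)) -
              (∫ y, (t y a - meanT (pm x) t a) * (t y b - meanT (pm x) t b) ∂(νc x)) *
                (∫ y, (t y c - meanT (pm x) t c) * (t y d - meanT (pm x) t d) ∂(νc x)))) ∧
      (variance
          (fun ys : Fin N → Y =>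
            (N : ℝ)⁻¹ * ∑ k, (∑ a, dh x i a * (t (ys k) a - meanT (pm x) t a)) ^ 2)
          (Measure.pi fun _ => νc x) =
        (N : ℝ)⁻¹ * (∑ a, ∑ b, ∑ c, ∑ d,
          dh x i a * dh x i b * dh x i c * dh x i d *
            (∫ y, (t y a - meanT (pm x) t a) * (t y b - meanT (pm x) t b) *
              (t y c - meanT (pm x) t c) * (t y d - meanT (pm x) t d) ∂(νc x))) -
        (N : ℝ)⁻¹ * (∑ a, ∑ b, dh x i a *
            (covT (νc x) t a b +
              (meanT (pm x) t a - meanT (νc x) t a) * (meanT (pm x) t b - meanT (νc x) t b)) *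
            dh x i b) ^ 2) := by
  intro x i
  have := hνc x
  set η := meanT (pm x) t
  have hs : Measurable fun y a => t y a - η a := by fun_prop
  obtain ⟨hmem, hvar⟩ := variance_sq_sum_mul hs (ht4 x) (dh x i)
  have hcoord a : Integrable (fun y => t y a) (νc x) :=
    ((integrable_coord hs (ht4 x) a).add (integrable_const (η a))).congr
      (Filter.Eventually.of_forall fun y => sub_add_cancel (t y a) (η a))
  have hI a b := integral_sub_mul_sub η (hcoord a) (hcoord b)
    ((memLp_two_mul hs (ht4 x) a b).integrable one_le_two)
  rw [variance_empirical_mean hN (νc x) hmem, hvar]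
  constructor
  · rw [sq_quadratic_form]
    simp only [← Finset.sum_sub_distrib, ← mul_sub]
  · simp only [hI]
    rw [mul_sub]
    congr 3
    exact Finset.sum_congr rfl fun a _ => Finset.sum_congr rfl fun b _ => by ring

end FIMPaper
end
end
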